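/- Let X be a Markov chain on E with transition kernel P and n-step transition probabilities P_n(x,·), admitting an invariant probability measure μ. Assume that for every pair x, y ∈ E there exists n with P_n(x,·) and P_n(y,·) mutually absolutely continuous (equivalent). Then for every pair (x₁, x₂) ∈ E × E, the total variation distance ‖P_n(x₁,·) − P_n(x₂,·)‖ tends to 0 as n → ∞. -/

import Mathlib

open MeasureTheory ProbabilityTheory Filter ENNReal

/-- The total variation distance `‖μ - ν‖` between two (probability) measures,
with values in `[0,2]`: `‖μ - ν‖ = 2 ⨆_{A measurable} |μ A - ν A|`. -/
noncomputable def tvDist {E : Type*} [MeasurableSpace E] (μ ν : Measure E) : ℝ≥0∞ :=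
  2 * ⨆ (A : Set E) (_ : MeasurableSet A), ((μ A - ν A) ⊔ (ν A - μ A))

/-- The `n`-step transition kernel `P_n` of a Markov kernel `P`. -/
noncomputable def nStep {E : Type*} [MeasurableSpace E] (P : ProbabilityTheory.Kernel E E) :
    ℕ → ProbabilityTheory.Kernel E E
  | 0 => ProbabilityTheory.Kernel.id
  | n + 1 => (nStep P n) ∘ₖ P

section TotalVariation

variable {α E : Type*} [MeasurableSpace α] [MeasurableSpace E]

lemma tvDist_comm (μ ν : Measure E) : tvDist μ ν = tvDist ν μ := by
  simp only [tvDist, sup_comm]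

lemma two_mul_sub_le_tvDist (μ ν : Measure E) {A : Set E} (hA : MeasurableSet A) :
    2 * (μ A - ν A) ≤ tvDist μ ν := by
  unfold tvDist
  gcongr
  exact le_sup_left.trans (le_iSup₂ (f := fun (A : Set E) (_ : MeasurableSet A) ↦
    (μ A - ν A) ⊔ (ν A - μ A)) A hA)

lemma tvDist_le {μ ν : Measure E} {c : ℝ≥0∞}
    (h₁ : ∀ A, MeasurableSet A → 2 * (μ A - ν A) ≤ c)
    (h₂ : ∀ A, MeasurableSet A → 2 * (ν A - μ A) ≤ c) : tvDist μ ν ≤ c := by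
  simp only [tvDist, ENNReal.mul_iSup, iSup_le_iff]
  intro A hA
  rcases le_total (μ A - ν A) (ν A - μ A) with h | h
  · rw [sup_eq_right.2 h]
    exact h₂ A hA
  · rw [sup_eq_left.2 h]
    exact h₁ A hA

lemma tvDist_triangle (μ ν ρ : Measure E) : tvDist μ ρ ≤ tvDist μ ν + tvDist ν ρ := by
  have key (μ ν ρ : Measure E) (A : Set E) (hA : MeasurableSet A) :
      2 * (μ A - ρ A) ≤ tvDist μ ν + tvDist ν ρ :=
    calc 2 * (μ A - ρ A) ≤ 2 * ((μ A - ν A) + (ν A - ρ A)) := by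
          gcongr
          exact tsub_le_tsub_add_tsub
      _ ≤ _ := by
          rw [mul_add]
          exact add_le_add (two_mul_sub_le_tvDist μ ν hA) (two_mul_sub_le_tvDist ν ρ hA)
  refine tvDist_le (key μ ν ρ) fun A hA ↦ ?_
  rw [tvDist_comm μ ν, tvDist_comm ν ρ, add_comm]
  exact key ρ ν μ A hA

lemma tvDist_le_two (μ ν : Measure E) [IsProbabilityMeasure μ] [IsProbabilityMeasure ν] :
    tvDist μ ν ≤ 2 := by
  refine tvDist_le (fun A _ ↦ ?_) fun A _ ↦ ?_ <;>
  · refine (mul_le_mul_right (tsub_le_self.trans prob_le_one) 2).trans ?_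
    simp

/-- Markov kernels contract the total variation distance. -/
lemma tvDist_comp_le (μ ν : Measure α) [IsFiniteMeasure μ] [IsFiniteMeasure ν]
    (κ : Kernel α E) [IsMarkovKernel κ] :
    tvDist (μ.bind κ) (ν.bind κ) ≤ tvDist μ ν := by
  have key (μ ν : Measure α) [IsFiniteMeasure μ] [IsFiniteMeasure ν] (A : Set E)
      (hA : MeasurableSet A) : 2 * (μ.bind κ A - ν.bind κ A) ≤ tvDist μ ν := by
    obtain ⟨s, hs⟩ := exists_isHahnDecomposition ν μ
    refine le_trans (mul_le_mul_right ?_ 2) (two_mul_sub_le_tvDist μ ν hs.measurableSet)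
    rw [tsub_le_iff_left, Measure.bind_apply hA κ.aemeasurable,
      Measure.bind_apply hA κ.aemeasurable, ← lintegral_add_compl _ hs.measurableSet,
      ← lintegral_add_compl (μ := ν) _ hs.measurableSet]
    have h₁ : ∫⁻ a in s, κ a A ∂μ ≤ ∫⁻ a in s, κ a A ∂ν + (μ s - ν s) := by
      conv_lhs => rw [← Measure.sub_add_cancel_of_le hs.le_on, lintegral_add_measure, add_comm]
      gcongr
      calc ∫⁻ a, κ a A ∂(μ.restrict s - ν.restrict s)
          ≤ ∫⁻ _, 1 ∂(μ.restrict s - ν.restrict s) := lintegral_mono fun a ↦ prob_le_one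
        _ = μ s - ν s := by
          rw [lintegral_one, Measure.sub_apply MeasurableSet.univ hs.le_on]
          simp
    have h₂ : ∫⁻ a in sᶜ, κ a A ∂μ ≤ ∫⁻ a in sᶜ, κ a A ∂ν :=
      lintegral_mono' hs.ge_on_compl le_rfl
    calc _ ≤ (∫⁻ a in s, κ a A ∂ν + (μ s - ν s)) + ∫⁻ a in sᶜ, κ a A ∂ν := add_le_add h₁ h₂
      _ = _ := by ring
  refine tvDist_le (key μ ν) fun A hA ↦ ?_
  rw [tvDist_comm]
  exact key ν μ A hA

/-- The independent coupling bounds the distance between two mixtures of a Markov kernel. -/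
lemma tvDist_comp_le_lintegral (μ ν : Measure α) [IsProbabilityMeasure μ]
    [IsProbabilityMeasure ν] (κ : Kernel α E) :
    tvDist (μ.bind κ) (ν.bind κ) ≤ ∫⁻ p, tvDist (κ p.1) (κ p.2) ∂μ.prod ν := by
  have hfst (A : Set E) (hA : MeasurableSet A) :
      μ.bind κ A = ∫⁻ p, κ p.1 A ∂μ.prod ν := by
    rw [Measure.bind_apply hA κ.aemeasurable,
      ← (measurePreserving_fst (μ := μ) (ν := ν)).lintegral_comp (κ.measurable_coe hA)]
  have hsnd (A : Set E) (hA : MeasurableSet A) :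
      ν.bind κ A = ∫⁻ p, κ p.2 A ∂μ.prod ν := by
    rw [Measure.bind_apply hA κ.aemeasurable,
      ← (measurePreserving_snd (μ := μ) (ν := ν)).lintegral_comp (κ.measurable_coe hA)]
  refine tvDist_le (fun A hA ↦ ?_) fun A hA ↦ ?_
  · rw [hfst A hA, hsnd A hA]
    refine (mul_le_mul_right (lintegral_sub_le _ _
      ((κ.measurable_coe hA).comp measurable_snd)) 2).trans ?_
    rw [← lintegral_const_mul' _ _ (by simp)]
    exact lintegral_mono fun p ↦ two_mul_sub_le_tvDist _ _ hA
  · rw [hfst A hA, hsnd A hA]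
    refine (mul_le_mul_right (lintegral_sub_le _ _
      ((κ.measurable_coe hA).comp measurable_fst)) 2).trans ?_
    rw [← lintegral_const_mul' _ _ (by simp)]
    refine lintegral_mono fun p ↦ ?_
    rw [tvDist_comm]
    exact two_mul_sub_le_tvDist _ _ hA

/-- A countable family of sets suffices to compute the distance of any two finite measures. -/
lemma exists_countable_tvDist_eq_iSup (E : Type*) [MeasurableSpace E]
    [MeasurableSpace.CountablyGenerated E] :
    ∃ 𝒜 : Set (Set E), 𝒜.Countable ∧ (∀ A ∈ 𝒜, MeasurableSet A) ∧
      ∀ μ ν : Measure E, IsFiniteMeasure μ → IsFiniteMeasure ν →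
        tvDist μ ν = ⨆ A ∈ 𝒜, (2 * (μ A - ν A)) ⊔ (2 * (ν A - μ A)) := by
  let 𝒜 := generateSetAlgebra (MeasurableSpace.countableGeneratingSet E)
  have hgen : ‹MeasurableSpace E› = MeasurableSpace.generateFrom 𝒜 := by
    rw [generateFrom_generateSetAlgebra_eq, MeasurableSpace.generateFrom_countableGeneratingSet]
  have hmeas : ∀ A ∈ 𝒜, MeasurableSet A := fun A hA ↦
    hgen ▸ MeasurableSpace.measurableSet_generateFrom hA
  refine ⟨𝒜, countable_generateSetAlgebra MeasurableSpace.countable_countableGeneratingSet,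
    hmeas, fun μ ν _ _ ↦ ?_⟩
  set S := ⨆ A ∈ 𝒜, (2 * (μ A - ν A)) ⊔ (2 * (ν A - μ A)) with hS
  have hle (B : Set E) (hB : B ∈ 𝒜) : (2 * (μ B - ν B)) ⊔ (2 * (ν B - μ B)) ≤ S :=
    le_iSup₂ (f := fun (A : Set E) (_ : A ∈ 𝒜) ↦ (2 * (μ A - ν A)) ⊔ (2 * (ν A - μ A))) B hB
  have dense : (μ + ν).MeasureDense 𝒜 :=
    Measure.MeasureDense.of_generateFrom_isSetAlgebra_finite (μ + ν)
      isSetAlgebra_generateSetAlgebra hgen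
  have key (ρ σ : Measure E) (hρ : ρ ≤ μ + ν) (hσ : σ ≤ μ + ν)
      (hB : ∀ B ∈ 𝒜, 2 * (ρ B - σ B) ≤ S) (A : Set E) (hA : MeasurableSet A) :
      2 * (ρ A - σ A) ≤ S := by
    refine ENNReal.le_of_forall_pos_le_add fun ε hε _ ↦ ?_
    obtain ⟨B, hB𝒜, hAB⟩ := dense.approx A hA (measure_ne_top _ _) (ε / 4) (by positivity)
    have h₁ : ρ A ≤ ρ B + ENNReal.ofReal (ε / 4) :=
      calc ρ A ≤ ρ (B ∪ symmDiff A B) := measure_mono fun x hx ↦ by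
            by_cases hxB : x ∈ B
            · exact Or.inl hxB
            · exact Or.inr (Or.inl ⟨hx, hxB⟩)
        _ ≤ ρ B + ρ (symmDiff A B) := measure_union_le _ _
        _ ≤ _ := by gcongr; exact (hρ _).trans hAB.le
    have h₂ : σ B ≤ σ A + ENNReal.ofReal (ε / 4) :=
      calc σ B ≤ σ (A ∪ symmDiff A B) := measure_mono fun x hx ↦ by
            by_cases hxA : x ∈ A
            · exact Or.inl hxA
            · exact Or.inr (Or.inr ⟨hx, hxA⟩)
        _ ≤ σ A + σ (symmDiff A B) := measure_union_le _ _
        _ ≤ _ := by gcongr; exact (hσ _).trans hAB.le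
    have h₃ : ρ A - σ A ≤ (ρ B - σ B) + (ENNReal.ofReal (ε / 4) + ENNReal.ofReal (ε / 4)) := by
      rw [tsub_le_iff_left]
      calc ρ A ≤ ρ B + ENNReal.ofReal (ε / 4) := h₁
        _ ≤ (σ B + (ρ B - σ B)) + ENNReal.ofReal (ε / 4) := by gcongr; exact le_add_tsub
        _ ≤ (σ A + ENNReal.ofReal (ε / 4) + (ρ B - σ B)) + ENNReal.ofReal (ε / 4) := by gcongr
        _ = _ := by ring
    have h₄ : 2 * (ENNReal.ofReal (ε / 4) + ENNReal.ofReal (ε / 4)) = ε := by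
      rw [← ENNReal.ofReal_add (by positivity) (by positivity), ← ENNReal.ofReal_ofNat,
        ← ENNReal.ofReal_mul (by positivity), ← ENNReal.ofReal_coe_nnreal]
      congr 1
      ring
    calc 2 * (ρ A - σ A)
        ≤ 2 * ((ρ B - σ B) + (ENNReal.ofReal (ε / 4) + ENNReal.ofReal (ε / 4))) := by gcongr
      _ = 2 * (ρ B - σ B) + ε := by rw [mul_add, h₄]
      _ ≤ S + ε := by gcongr; exact hB B hB𝒜
  apply le_antisymm
  · exact tvDist_le
      (key μ ν (Measure.le_add_right le_rfl) (Measure.le_add_left le_rfl)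
        fun B hB ↦ le_sup_left.trans (hle B hB))
      (key ν μ (Measure.le_add_left le_rfl) (Measure.le_add_right le_rfl)
        fun B hB ↦ le_sup_right.trans (hle B hB))
  · refine iSup₂_le fun A hA ↦ sup_le (two_mul_sub_le_tvDist μ ν (hmeas A hA)) ?_
    rw [tvDist_comm]
    exact two_mul_sub_le_tvDist ν μ (hmeas A hA)

lemma measurable_tvDist [MeasurableSpace.CountablyGenerated E]
    (κ η : Kernel α E) [IsFiniteKernel κ] [IsFiniteKernel η] :
    Measurable fun a ↦ tvDist (κ a) (η a) := by
  obtain ⟨𝒜, hc, hm, h⟩ := exists_countable_tvDist_eq_iSup E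
  simp_rw [fun a ↦ h (κ a) (η a) inferInstance inferInstance]
  refine Measurable.biSup 𝒜 hc fun A hA ↦ ?_
  have hκ := κ.measurable_coe (hm A hA)
  have hη := η.measurable_coe (hm A hA)
  exact ((hκ.sub hη).const_mul 2).sup ((hη.sub hκ).const_mul 2)

lemma tvDist_le_edist_toReal_rnDeriv {μ ν ρ : Measure E} [IsFiniteMeasure μ] [IsFiniteMeasure ν]
    [IsFiniteMeasure ρ] (hμ : μ ≪ ρ) (hν : ν ≪ ρ) :
    tvDist μ ν ≤ 2 * edist
      ((Measure.integrable_toReal_rnDeriv (μ := μ) (ν := ρ)).toL1 _)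
      ((Measure.integrable_toReal_rnDeriv (μ := ν) (ν := ρ)).toL1 _) := by
  have key (μ ν : Measure E) [IsFiniteMeasure μ] [IsFiniteMeasure ν] (hμ : μ ≪ ρ) (hν : ν ≪ ρ)
      (A : Set E) (hA : MeasurableSet A) : 2 * (μ A - ν A) ≤ 2 * edist
      ((Measure.integrable_toReal_rnDeriv (μ := μ) (ν := ρ)).toL1 _)
      ((Measure.integrable_toReal_rnDeriv (μ := ν) (ν := ρ)).toL1 _) := by
    rw [Integrable.edist_toL1_toL1]
    gcongr
    rw [← Measure.setLIntegral_rnDeriv hμ, ← Measure.setLIntegral_rnDeriv hν]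
    refine (lintegral_sub_le _ _ (Measure.measurable_rnDeriv _ _)).trans ?_
    refine (setLIntegral_le_lintegral _ _).trans (lintegral_mono_ae ?_)
    filter_upwards [Measure.rnDeriv_ne_top μ ρ, Measure.rnDeriv_ne_top ν ρ] with x h₁ h₂
    rw [edist_dist, Real.dist_eq]
    conv_lhs => rw [← ENNReal.ofReal_toReal h₁, ← ENNReal.ofReal_toReal h₂,
      ← ENNReal.ofReal_sub _ ENNReal.toReal_nonneg]
    exact ENNReal.ofReal_le_ofReal (le_abs_self _)
  refine tvDist_le (key μ ν hμ hν) ?_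
  rw [edist_comm]
  exact key ν μ hν hμ

/-- A dominated family of finite measures is separable in total variation. -/
lemma exists_countable_tvDist_lt [MeasurableSpace.CountablyGenerated E] {ι : Type*}
    (κ : ι → Measure E) [∀ i, IsFiniteMeasure (κ i)] (ρ : Measure E) [IsFiniteMeasure ρ]
    {ε : ℝ≥0∞} (hε : 0 < ε) :
    ∃ Z : Set ι, Z.Countable ∧ ∀ i, κ i ≪ ρ → ∃ z ∈ Z, tvDist (κ z) (κ i) < ε := by
  let F : {i // κ i ≪ ρ} → (E →₁[ρ] ℝ) := fun i ↦
    (Measure.integrable_toReal_rnDeriv (μ := κ i) (ν := ρ)).toL1 _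
  have : Fact ((1 : ℝ≥0∞) ≠ ∞) := ⟨by simp⟩
  obtain ⟨S, hS, hdense⟩ := TopologicalSpace.exists_countable_dense (Set.range F)
  refine ⟨(fun y : Set.range F ↦ (y.2.choose : ι)) '' S, hS.image _, fun i hi ↦ ?_⟩
  obtain ⟨y, hyS, hy⟩ := EMetric.mem_closure_iff.1 (hdense ⟨F ⟨i, hi⟩, Set.mem_range_self _⟩)
    (ε / 2) (ENNReal.half_pos hε.ne')
  refine ⟨_, Set.mem_image_of_mem _ hyS, ?_⟩
  have hFy : F y.2.choose = y := y.2.choose_spec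
  calc tvDist (κ (y.2.choose : ι)) (κ i)
      ≤ 2 * edist (F y.2.choose) (F ⟨i, hi⟩) :=
        tvDist_le_edist_toReal_rnDeriv y.2.choose.2 hi
    _ < 2 * (ε / 2) := by
        rw [hFy, edist_comm]
        exact ENNReal.mul_lt_mul_right (by simp) (by simp) hy
    _ = ε := ENNReal.mul_div_cancel (by simp) (by simp)

end TotalVariation

section Invariance

variable {X : Type*} [MeasurableSpace X]

/-- A bounded nonnegative subharmonic function of a stationary chain is almost surely constant
along one step. -/
lemma ae_ae_eq_of_le_integral_of_invariant (κ : Kernel X X) [IsMarkovKernel κ]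
    (m : Measure X) [IsFiniteMeasure m] (hκ : κ.Invariant m) {h : X → ℝ} (hm : Measurable h)
    {M : ℝ} (h_nonneg : ∀ x, 0 ≤ h x) (hM : ∀ x, h x ≤ M) (hsub : ∀ x, h x ≤ ∫ y, h y ∂κ x) :
    ∀ᵐ x ∂m, ∀ᵐ y ∂κ x, h y = h x := by
  have hsq (x : X) : ‖h x ^ 2‖ ≤ M ^ 2 := by
    rw [Real.norm_of_nonneg (sq_nonneg _)]
    exact pow_le_pow_left₀ (h_nonneg x) (hM x) 2
  have hint (ν : Measure X) [IsFiniteMeasure ν] : Integrable h ν :=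
    Integrable.of_bound hm.aestronglyMeasurable M <| .of_forall fun x ↦ by
      rw [Real.norm_of_nonneg (h_nonneg x)]
      exact hM x
  have hint_sq (ν : Measure X) [IsFiniteMeasure ν] : Integrable (fun x ↦ h x ^ 2) ν :=
    Integrable.of_bound (hm.pow_const 2).aestronglyMeasurable (M ^ 2) <| .of_forall hsq
  have hint_cross (x : X) : Integrable (fun y ↦ 2 * h y * h x) (κ x) :=
    ((hint _).const_mul 2).mul_const _
  have hint_diff (x : X) : Integrable (fun y ↦ h y ^ 2 - 2 * h y * h x) (κ x) :=
    (hint_sq _).sub (hint_cross x)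
  have hint_dev (x : X) : Integrable (fun y ↦ (h y - h x) ^ 2) (κ x) := by
    simp_rw [sub_sq]
    exact (hint_diff x).add (integrable_const _)
  have hdev (x : X) : ∫ y, (h y - h x) ^ 2 ∂κ x ≤ ∫ y, h y ^ 2 ∂κ x - h x ^ 2 := by
    have : ∫ y, (h y - h x) ^ 2 ∂κ x
        = ∫ y, h y ^ 2 ∂κ x - 2 * (∫ y, h y ∂κ x) * h x + h x ^ 2 := by
      simp_rw [sub_sq]
      rw [integral_add (hint_diff x) (integrable_const _),
        integral_sub (hint_sq _) (hint_cross x), integral_mul_const, integral_const_mul]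
      simp
    rw [this]
    nlinarith [mul_le_mul_of_nonneg_right (hsub x) (h_nonneg x)]
  have hdev_nonneg (x : X) : 0 ≤ ∫ y, (h y - h x) ^ 2 ∂κ x :=
    integral_nonneg fun y ↦ sq_nonneg _
  have hint_comp : Integrable (fun x ↦ ∫ y, h y ^ 2 ∂κ x) m := by
    refine Integrable.of_bound ?_ (M ^ 2) <| .of_forall fun x ↦ ?_
    · exact ((hm.pow_const 2).stronglyMeasurable.integral_kernel).aestronglyMeasurable
    · refine (norm_integral_le_of_norm_le_const (.of_forall hsq)).trans ?_
      simp
  have hzero : ∫ x, (∫ y, h y ^ 2 ∂κ x - h x ^ 2) ∂m = 0 := by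
    have hcomp : (κ ∘ₖ Kernel.const Unit m) () = m := by
      rw [← Measure.comp_eq_comp_const_apply, hκ.def]
    have hiter := Kernel.integral_comp (η := κ)
      (κ := Kernel.const Unit m) (a := ()) (f := fun x ↦ h x ^ 2)
      (by rw [hcomp]; exact hint_sq m)
    rw [hcomp, Kernel.const_apply] at hiter
    rw [integral_sub hint_comp (hint_sq m), ← hiter, sub_self]
  have hae := (integral_eq_zero_iff_of_nonneg (fun x ↦ (hdev_nonneg x).trans (hdev x))
    (hint_comp.sub (hint_sq m))).1 hzero
  filter_upwards [hae] with x hx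
  have hx' : ∫ y, (h y - h x) ^ 2 ∂κ x = 0 :=
    le_antisymm ((hdev x).trans_eq hx) (hdev_nonneg x)
  filter_upwards [(integral_eq_zero_iff_of_nonneg (fun y ↦ sq_nonneg _) (hint_dev x)).1 hx']
    with y hy
  exact sub_eq_zero.1 (pow_eq_zero_iff two_ne_zero |>.1 hy)

lemma ProbabilityTheory.Kernel.Invariant.parallelComp_prod {Y : Type*} [MeasurableSpace Y]
    {κ : Kernel X X} {η : Kernel Y Y} [IsSFiniteKernel κ]
    [IsSFiniteKernel η] {μ : Measure X} {ν : Measure Y} [SFinite μ] [SFinite ν]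
    (hκ : κ.Invariant μ) (hη : η.Invariant ν) : (κ ∥ₖ η).Invariant (μ.prod ν) := by
  have h : κ ∥ₖ η = (κ ∥ₖ Kernel.id) ∘ₖ (Kernel.id ∥ₖ η) := by
    rw [Kernel.parallelComp_comp_parallelComp]
    simp
  rw [Kernel.Invariant, h, ← Measure.comp_assoc, ← Measure.prod_comp_right,
    ← Measure.prod_comp_left, hκ.def, hη.def]

end Invariance

section NStep

variable {E : Type*} [MeasurableSpace E] (P : Kernel E E)

instance [IsMarkovKernel P] (n : ℕ) : IsMarkovKernel (nStep P n) := by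
  induction n with
  | zero => exact inferInstanceAs (IsMarkovKernel Kernel.id)
  | succ n ih => exact inferInstanceAs (IsMarkovKernel (nStep P n ∘ₖ P))

lemma nStep_add (n m : ℕ) : nStep P (n + m) = nStep P m ∘ₖ nStep P n := by
  induction n with
  | zero => rw [zero_add, nStep, Kernel.comp_id]
  | succ n ih =>
    rw [Nat.add_right_comm, nStep, ih, Kernel.comp_assoc, ← nStep]

lemma nStep_add_apply (n m : ℕ) (x : E) :
    nStep P (n + m) x = (nStep P n x).bind (nStep P m) := by
  rw [nStep_add, Kernel.comp_apply]

variable {P}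

lemma nStep_invariant {μ : Measure E} (hP : P.Invariant μ) (n : ℕ) : (nStep P n).Invariant μ := by
  induction n with
  | zero => exact Measure.bind_dirac
  | succ n ih => exact ih.comp hP

lemma nStep_absolutelyContinuous_of_le {x y : E} {n m : ℕ} (hnm : n ≤ m)
    (h : nStep P n x ≪ nStep P n y) : nStep P m x ≪ nStep P m y := by
  obtain ⟨k, rfl⟩ := Nat.exists_eq_add_of_le hnm
  rw [nStep_add_apply, nStep_add_apply]
  exact h.comp_right _

end NStep

section LimitDistance

variable {E : Type*} [MeasurableSpace E] (P : Kernel E E)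

/-- The limit of the nonincreasing distances between `n`-step transition probabilities. -/
noncomputable def limTVDist (p : E × E) : ℝ≥0∞ := ⨅ n, tvDist (nStep P n p.1) (nStep P n p.2)

lemma limTVDist_le_tvDist (n : ℕ) (x y : E) :
    limTVDist P (x, y) ≤ tvDist (nStep P n x) (nStep P n y) :=
  iInf_le _ n

lemma limTVDist_comm (x y : E) : limTVDist P (x, y) = limTVDist P (y, x) := by
  simp only [limTVDist, tvDist_comm (nStep P _ x)]

variable [IsMarkovKernel P]

lemma tvDist_nStep_antitone (x y : E) :
    Antitone fun n ↦ tvDist (nStep P n x) (nStep P n y) := by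
  intro n m hnm
  obtain ⟨k, rfl⟩ := Nat.exists_eq_add_of_le hnm
  simp only [nStep_add_apply]
  exact tvDist_comp_le _ _ _

lemma tendsto_tvDist_nStep (x y : E) :
    Tendsto (fun n ↦ tvDist (nStep P n x) (nStep P n y)) atTop (nhds (limTVDist P (x, y))) :=
  tendsto_atTop_iInf (tvDist_nStep_antitone P x y)

lemma limTVDist_le_two (p : E × E) : limTVDist P p ≤ 2 :=
  (limTVDist_le_tvDist P 0 p.1 p.2).trans (tvDist_le_two _ _)

lemma limTVDist_triangle (x y z : E) :
    limTVDist P (x, z) ≤ limTVDist P (x, y) + limTVDist P (y, z) :=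
  le_of_tendsto_of_tendsto' (tendsto_tvDist_nStep P x z)
    ((tendsto_tvDist_nStep P x y).add (tendsto_tvDist_nStep P y z))
    fun _ ↦ tvDist_triangle _ _ _

variable [MeasurableSpace.CountablyGenerated E]

lemma measurable_tvDist_nStep (n : ℕ) :
    Measurable fun p : E × E ↦ tvDist (nStep P n p.1) (nStep P n p.2) :=
  measurable_tvDist ((nStep P n).comap Prod.fst measurable_fst)
    ((nStep P n).comap Prod.snd measurable_snd)

lemma measurable_limTVDist : Measurable (limTVDist P) :=
  .iInf fun n ↦ measurable_tvDist_nStep P n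

lemma limTVDist_le_lintegral (n : ℕ) (x y : E) :
    limTVDist P (x, y) ≤ ∫⁻ p, limTVDist P p ∂(nStep P n x).prod (nStep P n y) := by
  simp only [limTVDist]
  rw [lintegral_iInf (measurable_tvDist_nStep P)
    (fun _ _ h p ↦ tvDist_nStep_antitone P p.1 p.2 h)]
  · refine le_iInf fun k ↦ (limTVDist_le_tvDist P (n + k) x y).trans ?_
    rw [nStep_add_apply, nStep_add_apply]
    exact tvDist_comp_le_lintegral _ _ _
  · refine ((lintegral_mono fun p ↦ tvDist_le_two _ _).trans_lt ?_).ne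
    simp

/-- If all transition probabilities are eventually dominated by those of a single point, then
`E` is separable for the limit distance. -/
lemma exists_countable_limTVDist_lt (x₀ : E) (h : ∀ x, ∃ n, nStep P n x ≪ nStep P n x₀)
    {ε : ℝ≥0∞} (hε : 0 < ε) :
    ∃ Z : Set E, Z.Countable ∧ ∀ x, ∃ z ∈ Z, limTVDist P (z, x) < ε := by
  choose Z hZc hZ using fun n ↦ exists_countable_tvDist_lt (fun x ↦ nStep P n x) (nStep P n x₀) hε
  refine ⟨⋃ n, Z n, Set.countable_iUnion hZc, fun x ↦ ?_⟩
  obtain ⟨n, hn⟩ := h x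
  obtain ⟨z, hz, hlt⟩ := hZ n x hn
  exact ⟨z, Set.mem_iUnion.2 ⟨n, hz⟩, (limTVDist_le_tvDist P n z x).trans_lt hlt⟩

/-- The limit distance is almost surely constant along two independent stationary chains. -/
lemma ae_ae_limTVDist_eq {μ : Measure E} [IsFiniteMeasure μ] (hP : P.Invariant μ) (n : ℕ) :
    ∀ᵐ p ∂μ.prod μ, ∀ᵐ q ∂(nStep P n p.1).prod (nStep P n p.2),
      limTVDist P q = limTVDist P p := by
  have hne (p : E × E) : limTVDist P p ≠ ∞ := ne_top_of_le_ne_top (by simp) (limTVDist_le_two P p)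
  have hinv := (nStep_invariant hP n).parallelComp_prod (nStep_invariant hP n)
  have key := ae_ae_eq_of_le_integral_of_invariant _ _ hinv
    (measurable_limTVDist P).ennreal_toReal (M := 2) (fun _ ↦ ENNReal.toReal_nonneg)
    (fun p ↦ ENNReal.toReal_le_of_le_ofReal (by simp) (by simpa using limTVDist_le_two P p))
    (fun p ↦ by
      rw [Kernel.parallelComp_apply,
        integral_toReal (measurable_limTVDist P).aemeasurable
          (.of_forall fun q ↦ (hne q).lt_top)]
      refine ENNReal.toReal_mono ?_ (limTVDist_le_lintegral P n p.1 p.2)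
      refine ((lintegral_mono fun q ↦ limTVDist_le_two P q).trans_lt ?_).ne
      simp)
  filter_upwards [key] with p hp
  rw [Kernel.parallelComp_apply] at hp
  filter_upwards [hp] with q hq
  exact (ENNReal.toReal_eq_toReal_iff' (hne q) (hne p)).1 hq

lemma ae_limTVDist_eq_zero {μ : Measure E} [IsFiniteMeasure μ] (hP : P.Invariant μ)
    (h : ∀ x y, ∃ n, nStep P n x ≪ nStep P n y) :
    ∀ᵐ p ∂μ.prod μ, limTVDist P p = 0 := by
  filter_upwards [ae_all_iff.2 fun n ↦ ae_ae_limTVDist_eq P hP n] with p hp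
  obtain ⟨n, hn⟩ := h p.1 p.2
  by_contra hpos
  obtain ⟨Z, hZc, hZ⟩ := exists_countable_limTVDist_lt P p.1 (fun x ↦ h x p.1)
    (ENNReal.half_pos hpos)
  let B (z : E) : Set E := {x | limTVDist P (z, x) < limTVDist P p / 2}
  have hB (z : E) : MeasurableSet (B z) :=
    measurableSet_lt ((measurable_limTVDist P).comp measurable_prodMk_left) measurable_const
  obtain ⟨z, hzpos⟩ : ∃ z, nStep P n p.1 (B z) ≠ 0 := by
    by_contra! hzero
    have hcover : ⋃ z ∈ Z, B z = Set.univ := Set.eq_univ_of_forall fun x ↦ by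
      obtain ⟨z, hz, hlt⟩ := hZ x
      exact Set.mem_biUnion hz hlt
    have := (measure_biUnion_null_iff hZc).2 fun z (_ : z ∈ Z) ↦ hzero z
    simp [hcover] at this
  have hprod : ((nStep P n p.1).prod (nStep P n p.2)) (B z ×ˢ B z) ≠ 0 := by
    rw [Measure.prod_prod]
    exact mul_ne_zero hzpos fun h0 ↦ hzpos (hn h0)
  obtain ⟨q, ⟨hq₁, hq₂⟩, hq⟩ : ∃ q ∈ B z ×ˢ B z, limTVDist P q = limTVDist P p := by
    by_contra! hcon
    exact hprod (measure_mono_null hcon (ae_iff.1 (hp n)))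
  have hlt : limTVDist P q < limTVDist P p :=
    calc limTVDist P q ≤ limTVDist P (q.1, z) + limTVDist P (z, q.2) :=
          limTVDist_triangle P q.1 z q.2
      _ < limTVDist P p / 2 + limTVDist P p / 2 := by
          rw [limTVDist_comm]
          exact ENNReal.add_lt_add hq₁ hq₂
      _ = limTVDist P p := ENNReal.add_halves _
  exact hlt.ne hq

lemma limTVDist_eq_zero {μ : Measure E} [IsProbabilityMeasure μ] (hP : P.Invariant μ)
    (h : ∀ x y, ∃ n, nStep P n x ≪ nStep P n y) (x₁ x₂ : E) : limTVDist P (x₁, x₂) = 0 := by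
  obtain ⟨y₀, hy₀⟩ := (Measure.ae_ae_of_ae_prod (ae_limTVDist_eq_zero P hP h)).exists
  have hstep : ∀ᵐ y ∂μ, ∀ n, ∀ᵐ z ∂nStep P n y, limTVDist P (y₀, z) = 0 :=
    ae_all_iff.2 fun n ↦ Measure.ae_ae_of_ae_comp (by rwa [(nStep_invariant hP n).def])
  obtain ⟨y₁, hy₁⟩ := hstep.exists
  obtain ⟨n₁, hn₁⟩ := h x₁ y₁
  obtain ⟨n₂, hn₂⟩ := h x₂ y₁
  set n := max n₁ n₂
  have hx₁ : ∀ᵐ z ∂nStep P n x₁, limTVDist P (y₀, z) = 0 :=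
    (nStep_absolutelyContinuous_of_le (le_max_left n₁ n₂) hn₁).ae_le (hy₁ n)
  have hx₂ : ∀ᵐ z ∂nStep P n x₂, limTVDist P (y₀, z) = 0 :=
    (nStep_absolutelyContinuous_of_le (le_max_right n₁ n₂) hn₂).ae_le (hy₁ n)
  refine le_antisymm ((limTVDist_le_lintegral P n x₁ x₂).trans_eq ?_) zero_le
  refine lintegral_eq_zero_of_ae_eq_zero ?_
  filter_upwards [Measure.quasiMeasurePreserving_fst.ae hx₁,
    Measure.quasiMeasurePreserving_snd.ae hx₂] with q h₁ h₂
  refine le_antisymm ((limTVDist_triangle P q.1 y₀ q.2).trans_eq ?_) zero_le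
  rw [limTVDist_comm, h₁, h₂, add_zero, Pi.zero_apply]

end LimitDistance

/-- If the chain admits an invariant probability measure `μ` and for every pair `x, y` some
`P_n(x,·) ∼ P_n(y,·)`, then `‖P_n(x₁,·) - P_n(x₂,·)‖ → 0` for every pair `(x₁, x₂)`. -/
theorem tv_dist_pairs_tendsto_zero_everywhere
    {E : Type*} [MeasurableSpace E] [MeasurableSpace.CountablyGenerated E]
    (hΔ : MeasurableSet {p : E × E | p.1 = p.2})
    (P : ProbabilityTheory.Kernel E E) [IsMarkovKernel P]
    (μ : Measure E) [IsProbabilityMeasure μ]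
    (hinv : ∀ A : Set E, MeasurableSet A → μ A = ∫⁻ x, P x A ∂μ)
    (hreg : ∀ x y : E, ∃ n : ℕ,
      nStep P n x ≪ nStep P n y ∧ nStep P n y ≪ nStep P n x) :
    ∀ x₁ x₂ : E,
      Tendsto (fun n => tvDist (nStep P n x₁) (nStep P n x₂)) atTop (nhds 0) := by

  intro x₁ x₂
  have hP : P.Invariant μ := by
    ext A hA
    rw [Measure.bind_apply hA P.aemeasurable, hinv A hA]
  rw [← limTVDist_eq_zero P hP (fun x y ↦ (hreg x y).imp fun _ h ↦ h.1) x₁ x₂]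
  exact tendsto_tvDist_nStep P x₁ x₂
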